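/- Let k be an infinite field, R a non-negatively graded Noetherian ring with R_0 = k, and M a graded R-module generated by homogeneous elements m_1,…,m_n all of the same degree. Fix integers r and s and assume that μ(M_𝔭) ≤ max{0, dim R_𝔭 + r} for every prime 𝔭 of R with dim R_𝔭 ≤ s − 1. Then for a general k-linear combination x of m_1,…,m_n, one has μ((M/Rx)_𝔭) ≤ max{0, dim R_𝔭 + r − 1} for every prime 𝔭 of R with dim R_𝔭 ≤ s − 1. -/

import Mathlib

/-!
Statement 19 (Proposition `10.14a` of the paper).

`k` is an infinite field, `R` a non-negatively graded Noetherian ring with `R₀ = k`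
(encoded: `𝒜 0` is an infinite field), and `M` a graded `R`-module generated by
homogeneous elements `m₁,…,mₙ` all of the same degree.  For fixed integers `r`, `s`,
assume `μ(M_𝔭) ≤ max{0, dim R_𝔭 + r}` for every prime `𝔭` with `dim R_𝔭 ≤ s − 1`.
Then for a general `k`-linear combination `x = Σ λᵢ mᵢ` (i.e. for all coefficient
vectors `λ ∈ kⁿ` avoiding the zero locus of some nonzero polynomial `f`),
`μ((M/Rx)_𝔭) ≤ max{0, dim R_𝔭 + r − 1}` for every prime `𝔭` with `dim R_𝔭 ≤ s − 1`.

`μ(N) ≤ b` is rendered as: `N` admits a generating set of cardinality `≤ b` over the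
local ring `R_𝔭 = Localization.AtPrime 𝔭`, and `dim R_𝔭` via `ringKrullDim` (every
prime of a Noetherian ring has finite height, quantified as `h` below).
-/

noncomputable section
namespace Paper

variable {R : Type} [CommRing R]

/-- The localized module `N_𝔭` can be generated by at most `b` elements
(over `R_𝔭`); `b : ℤ`, so this is vacuous when `b < 0` except that no generating set
of nonnegative size exists. -/
def LocCanGenBy (𝔭 : PrimeSpectrum R) (N : Type) [AddCommGroup N] [Module R N]
    (b : ℤ) : Prop :=
  ∃ T : Finset (LocalizedModule 𝔭.asIdeal.primeCompl N),
    (T.card : ℤ) ≤ b ∧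
    Submodule.span (Localization.AtPrime 𝔭.asIdeal)
      (↑T : Set (LocalizedModule 𝔭.asIdeal.primeCompl N)) = ⊤

section LocalGenerators

variable {M : Type*} [AddCommGroup M] [Module R M]

/-- The elements of `M` that some element of `S` multiplies into `N`. -/
def saturation (S : Submonoid R) (N : Submodule R M) : Submodule R M where
  carrier := {x | ∃ u ∈ S, u • x ∈ N}
  zero_mem' := ⟨1, S.one_mem, by simp⟩
  add_mem' := by
    rintro x y ⟨u, hu, hx⟩ ⟨v, hv, hy⟩
    refine ⟨u * v, S.mul_mem hu hv, ?_⟩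
    rw [smul_add]
    refine N.add_mem ?_ ?_
    · rw [mul_comm, mul_smul]
      exact N.smul_mem _ hx
    · rw [mul_smul]
      exact N.smul_mem _ hy
  smul_mem' := by
    rintro c x ⟨u, hu, hx⟩
    refine ⟨u, hu, ?_⟩
    rw [smul_comm]
    exact N.smul_mem _ hx

theorem exists_smul_mem_of_saturation_eq_top [Module.Finite R M] {S : Submonoid R}
    {N : Submodule R M} (h : saturation S N = ⊤) : ∃ u ∈ S, ∀ x : M, u • x ∈ N := by
  classical
  obtain ⟨G, hG⟩ := Module.Finite.fg_top (R := R) (M := M)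
  have hmem (x : M) : ∃ u ∈ S, u • x ∈ N := by
    have : x ∈ saturation S N := h ▸ Submodule.mem_top
    exact this
  choose u hu hux using hmem
  refine ⟨∏ x ∈ G, u x, S.prod_mem fun x _ ↦ hu x, fun x ↦ ?_⟩
  suffices ⊤ ≤ N.comap (LinearMap.lsmul R M (∏ x ∈ G, u x)) from this Submodule.mem_top
  rw [← hG, Submodule.span_le]
  intro y hy
  change (∏ x ∈ G, u x) • y ∈ N
  rw [← Finset.prod_erase_mul _ _ hy, mul_smul]
  exact N.smul_mem _ (hux y)

/-- The localization of `M` at the prime `p` is generated by the images of at most `b` elements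
of `M`, up to a single denominator. -/
def SpannedNear (p : Ideal R) (M : Type*) [AddCommGroup M] [Module R M] (b : ℕ) : Prop :=
  ∃ T : Finset M, T.card ≤ b ∧ ∃ u ∉ p, ∀ x : M, u • x ∈ Submodule.span R (T : Set M)

theorem SpannedNear.mono {p : Ideal R} {a b : ℕ} (h : SpannedNear p M a) (hab : a ≤ b) :
    SpannedNear p M b := by
  obtain ⟨T, hT, hu⟩ := h
  exact ⟨T, hT.trans hab, hu⟩

theorem SpannedNear.quotient {p : Ideal R} {b : ℕ} (h : SpannedNear p M b)
    (N : Submodule R M) : SpannedNear p (M ⧸ N) b := by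
  classical
  obtain ⟨T, hT, u, hu, hspan⟩ := h
  refine ⟨T.image N.mkQ, Finset.card_image_le.trans hT, u, hu, fun x ↦ ?_⟩
  obtain ⟨x, rfl⟩ := N.mkQ_surjective x
  rw [Finset.coe_image, ← Submodule.map_span, ← map_smul]
  exact Submodule.mem_map_of_mem (hspan x)

/-- Dividing out an element outside `pM_p` lowers the local number of generators. -/
theorem SpannedNear.quotient_span_singleton {p : Ideal R} [p.IsPrime] {b : ℕ}
    (h : SpannedNear p M (b + 1)) {x : M}
    (hx : x ∉ saturation p.primeCompl (p • (⊤ : Submodule R M))) :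
    SpannedNear p (M ⧸ Submodule.span R {x}) b := by
  classical
  obtain ⟨T, hT, u, hu, hspan⟩ := h
  obtain ⟨c, -, hc⟩ := Submodule.mem_span_finset.mp (hspan x)
  obtain ⟨a, haT, hca⟩ : ∃ a ∈ T, c a ∉ p := by
    by_contra! hall
    refine hx ⟨u, hu, hc ▸ Submodule.sum_mem _ fun a ha ↦ ?_⟩
    exact Submodule.smul_mem_smul (hall a ha) Submodule.mem_top
  set π := (Submodule.span R {x}).mkQ with hπ
  have hπx : π x = 0 := by simp [hπ, Submodule.mem_span_singleton_self]
  set P := Submodule.span R (((T.erase a).image π : Finset _) : Set (M ⧸ Submodule.span R {x}))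
    with hP
  have hmem {y : M} (hy : y ∈ T.erase a) : π y ∈ P :=
    Submodule.subset_span (by exact_mod_cast Finset.mem_image_of_mem π hy)
  have ha : c a • π a ∈ P := by
    have hsum : c a • π a = -∑ y ∈ T.erase a, c y • π y := by
      rw [eq_neg_iff_add_eq_zero, Finset.add_sum_erase _ (fun y ↦ c y • π y) haT]
      simp_rw [← map_smul]
      rw [← map_sum, hc, map_smul, hπx, smul_zero]
    rw [hsum]
    exact P.neg_mem (P.sum_mem fun y hy ↦ P.smul_mem _ (hmem hy))
  have hle : Submodule.span R (T : Set M) ≤ P.comap (c a • π) := by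
    refine Submodule.span_le.mpr fun y hy ↦ ?_
    by_cases hya : y = a
    · simpa [hya] using ha
    · exact P.smul_mem _ (hmem (Finset.mem_erase.mpr ⟨hya, hy⟩))
  refine ⟨(T.erase a).image π, Finset.card_image_le.trans ?_, c a * u,
    Ideal.IsPrime.mul_notMem ‹_› hca hu, fun y ↦ ?_⟩
  · rw [Finset.card_erase_of_mem haT]
    omega
  · obtain ⟨y, rfl⟩ := (Submodule.span R {x}).mkQ_surjective y
    rw [mul_smul, ← map_smul]
    exact hle (hspan y)

/-- Nakayama's lemma at a prime. -/
theorem spannedNear_zero_of_saturation_eq_top [Module.Finite R M] {p : Ideal R} [p.IsPrime]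
    (h : saturation p.primeCompl (p • (⊤ : Submodule R M)) = ⊤) : SpannedNear p M 0 := by
  obtain ⟨u, hu, hux⟩ := exists_smul_mem_of_saturation_eq_top h
  obtain ⟨q, hq, -, hcoeff, hq0⟩ :=
    LinearMap.exists_monic_and_natDegree_eq_and_coeff_mem_pow_and_aeval_eq_zero R
      (algebraMap R (Module.End R M) u) p (by rintro _ ⟨x, rfl⟩; exact hux x)
  refine ⟨∅, le_rfl, q.eval u, fun hmem ↦ ?_, fun x ↦ ?_⟩
  · rw [Polynomial.eval_eq_sum_range, Finset.sum_range_succ, hq.coeff_natDegree, one_mul] at hmem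
    refine hu (Ideal.IsPrime.mem_of_pow_mem ‹_› _ ((p.add_mem_iff_right ?_).mp hmem))
    refine p.sum_mem fun k hk ↦ p.mul_mem_right _ (Ideal.pow_le_self ?_ (hcoeff k))
    have := Finset.mem_range.mp hk
    omega
  · rw [Polynomial.aeval_algebraMap_apply] at hq0
    have := LinearMap.congr_fun hq0 x
    simpa using this

/-- The primes at which `M` needs more than `b` generators form a closed set. -/
theorem exists_ideal_le_iff_not_spannedNear (M : Type*) [AddCommGroup M] [Module R M] (b : ℕ) :
    ∃ J : Ideal R, ∀ p : Ideal R, J ≤ p ↔ ¬ SpannedNear p M b := by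
  refine ⟨Ideal.span {u | ∃ T : Finset M, T.card ≤ b ∧
    ∀ x : M, u • x ∈ Submodule.span R (T : Set M)}, fun p ↦ ?_⟩
  rw [Ideal.span_le]
  constructor
  · rintro h ⟨T, hT, u, hu, hux⟩
    exact hu (h ⟨T, hT, hux⟩)
  · rintro h u ⟨T, hT, hux⟩
    by_contra hu
    exact h ⟨T, hT, u, hu, hux⟩

end LocalGenerators

theorem locCanGenBy_iff_spannedNear {M : Type} [AddCommGroup M] [Module R M] [Module.Finite R M]
    (p : PrimeSpectrum R) (b : ℕ) : LocCanGenBy p M b ↔ SpannedNear p.asIdeal M b := by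
  classical
  let S := p.asIdeal.primeCompl
  let A := Localization.AtPrime p.asIdeal
  let f := LocalizedModule.mkLinearMap S M
  constructor
  · rintro ⟨T, hT, hspan⟩
    choose num hnum using IsLocalizedModule.mk'_surjective S f
    let T' := T.image fun t ↦ (num t).1
    refine ⟨T', Finset.card_image_le.trans (by exact_mod_cast hT), ?_⟩
    refine exists_smul_mem_of_saturation_eq_top (S := S) (eq_top_iff.mpr fun x _ ↦ ?_)
    have htop : (Submodule.span R (T' : Set M)).localized' A S f = ⊤ := by
      rw [eq_top_iff, ← hspan, Submodule.span_le]
      intro t ht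
      rw [← hnum t]
      refine ⟨(num t).1, Submodule.subset_span ?_, (num t).2, rfl⟩
      exact_mod_cast Finset.mem_image_of_mem (fun t ↦ (num t).1) ht
    obtain ⟨y, hy, s, hs⟩ : f x ∈ (Submodule.span R (T' : Set M)).localized' A S f :=
      htop ▸ Submodule.mem_top
    rw [IsLocalizedModule.mk'_eq_iff, ← LinearMap.map_smul_of_tower] at hs
    obtain ⟨v, hv⟩ := IsLocalizedModule.exists_of_eq (S := S) hs
    refine ⟨v * s, S.mul_mem v.2 s.2, ?_⟩
    rw [mul_smul]
    change v • s • x ∈ _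
    rw [← hv]
    exact Submodule.smul_mem _ _ hy
  · rintro ⟨T, hT, u, hu, hux⟩
    refine ⟨T.image f, by exact_mod_cast Finset.card_image_le.trans hT, ?_⟩
    rw [Finset.coe_image, ← Submodule.localized'_span A S f, eq_top_iff,
      ← Submodule.localized'_top A S f]
    refine Submodule.localized'_le_localized'_of_smul_le A S f (⟨u, hu⟩ : S) ?_
    rintro _ ⟨x, -, rfl⟩
    exact hux x

/-- If the `m i` do not all lie in the submodule `N`, then neither does a general linear
combination of them. -/
theorem exists_mvPolynomial_forall_sum_smul_notMem {K A M ι : Type*} [Field K] [CommRing A]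
    [Algebra K A] [AddCommGroup M] [Module A M] [Fintype ι] (N : Submodule A M) (m : ι → M)
    {i : ι} (hi : m i ∉ N) :
    ∃ f : MvPolynomial ι K, f ≠ 0 ∧
      ∀ c : ι → K, MvPolynomial.eval c f ≠ 0 → ∑ j, algebraMap K A (c j) • m j ∉ N := by
  classical
  let : Module K M := Module.compHom M (algebraMap K A)
  have : IsScalarTower K A M := IsScalarTower.of_algebraMap_smul fun _ _ ↦ rfl
  let W := (N.restrictScalars K).comap (Fintype.linearCombination K m)
  have hW : Pi.single i 1 ∉ W := by simpa [W] using hi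
  obtain ⟨l, hl, hWl⟩ := Submodule.exists_le_ker_of_notMem hW
  let f : MvPolynomial ι K := ∑ j, MvPolynomial.C (l (Pi.single j 1)) * MvPolynomial.X j
  have hf (c : ι → K) : MvPolynomial.eval c f = l c := by
    rw [LinearMap.pi_apply_eq_sum_univ l c]
    simp only [f, map_sum, map_mul, MvPolynomial.eval_C, MvPolynomial.eval_X, smul_eq_mul]
    refine Finset.sum_congr rfl fun j _ ↦ ?_
    rw [mul_comm]
    congr 2
    ext k
    simp [Pi.single_apply, eq_comm]
  refine ⟨f, fun h0 ↦ hl ?_, fun c hc hmem ↦ hc ?_⟩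
  · rw [← hf, h0, map_zero]
  · rw [hf]
    refine hWl ?_
    simpa [W, Fintype.linearCombination_apply, algebraMap_smul] using hmem

/-- The basic element theorem over a field, with the bound on the local number of generators
expressed through `SpannedNear`. -/
theorem exists_mvPolynomial_forall_spannedNear_quotient {A : Type} {K M ι : Type*} [Field K]
    [CommRing A] [IsNoetherianRing A] [Algebra K A] [AddCommGroup M] [Module A M] [Fintype ι] (m : ι → M)
    (hm : Submodule.span A (Set.range m) = ⊤) (r s : ℤ)
    (hmu : ∀ (p : Ideal A) [p.IsPrime] (h : ℕ), p.height = h → (h : ℤ) ≤ s - 1 →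
      SpannedNear p M (h + r).toNat) :
    ∃ f : MvPolynomial ι K, f ≠ 0 ∧ ∀ c : ι → K, MvPolynomial.eval c f ≠ 0 →
      ∀ (p : Ideal A) [p.IsPrime] (h : ℕ), p.height = h → (h : ℤ) ≤ s - 1 →
        SpannedNear p (M ⧸ Submodule.span A {∑ i, algebraMap K A (c i) • m i})
          (h + r - 1).toNat := by
  classical
  have : Module.Finite A M := ⟨⟨Finset.univ.image m, by simpa using hm⟩⟩
  choose J hJ using fun b ↦ exists_ideal_le_iff_not_spannedNear (R := A) M b
  have hcard (p : Ideal A) [hp : p.IsPrime] : SpannedNear p M (Fintype.card ι) :=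
    ⟨Finset.univ.image m, Finset.card_image_le, 1, p.one_notMem, by simp [hm]⟩
  have hfin : (⋃ b ∈ Finset.range (Fintype.card ι), (J b).minimalPrimes).Finite :=
    (Finset.range _).finite_toSet.biUnion fun b _ ↦
      (J b).finite_minimalPrimes_of_isNoetherianRing
  have hgen (p : Ideal A) : ∃ f : MvPolynomial ι K, f ≠ 0 ∧ ∀ [p.IsPrime], ¬ SpannedNear p M 0 →
      ∀ c : ι → K, MvPolynomial.eval c f ≠ 0 → ∑ j, algebraMap K A (c j) • m j ∉
        saturation p.primeCompl (p • (⊤ : Submodule A M)) := by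
    by_cases hp : p.IsPrime
    · by_cases h0 : SpannedNear p M 0
      · exact ⟨1, one_ne_zero, fun h ↦ absurd h0 h⟩
      · obtain ⟨i, hi⟩ : ∃ i, m i ∉ saturation p.primeCompl (p • (⊤ : Submodule A M)) := by
          by_contra! hall
          refine h0 (spannedNear_zero_of_saturation_eq_top ?_)
          refine eq_top_iff.mpr (hm.ge.trans (Submodule.span_le.mpr ?_))
          rintro _ ⟨i, rfl⟩
          exact hall i
        obtain ⟨f, hf, hfc⟩ := exists_mvPolynomial_forall_sum_smul_notMem (K := K) _ m hi
        exact ⟨f, hf, fun _ ↦ hfc⟩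
    · exact ⟨1, one_ne_zero, fun {h} ↦ absurd h hp⟩
  choose F hF0 hF using hgen
  refine ⟨∏ p ∈ hfin.toFinset, F p, Finset.prod_ne_zero_iff.mpr fun p _ ↦ hF0 p, ?_⟩
  intro c hc p hp h hph hs
  rw [map_prod, Finset.prod_ne_zero_iff] at hc
  have hsp := hmu p h hph hs
  obtain hb | ⟨b, hb⟩ : (h + r).toNat = 0 ∨ ∃ b : ℕ, (h + r : ℤ) = b + 1 := by
    rcases le_or_gt (h + r : ℤ) 0 with h0 | h0
    · exact Or.inl (Int.toNat_of_nonpos h0)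
    · exact Or.inr ⟨(h + r - 1).toNat, by omega⟩
  · exact ((hb ▸ hsp).quotient _).mono (Nat.zero_le _)
  rw [show (h + r - 1 : ℤ).toNat = b by omega]
  rw [show (h + r : ℤ).toNat = b + 1 by omega] at hsp
  by_cases hpb : SpannedNear p M b
  · exact hpb.quotient _
  have hbn : b < Fintype.card ι := by
    by_contra! hle
    exact hpb ((hcard p).mono hle)
  have hmin : p ∈ (J b).minimalPrimes := by
    refine ⟨⟨hp, (hJ b p).mpr hpb⟩, fun q ⟨hq, hJq⟩ hqp ↦ ?_⟩
    by_contra hpq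
    have := q.finiteHeight_of_isNoetherianRing
    have hlt := Ideal.height_strict_mono_of_isPrime (lt_of_le_not_ge hqp hpq)
    obtain ⟨h', hh'⟩ := ENat.ne_top_iff_exists.mp (Ideal.height_ne_top hq.ne_top)
    rw [hph, ← hh', Nat.cast_lt] at hlt
    exact (hJ b q).mp hJq ((hmu q h' hh'.symm (by omega)).mono (by omega))
  refine hsp.quotient_span_singleton (hF p (fun h0 ↦ hpb (h0.mono (Nat.zero_le _))) c (hc p ?_))
  rw [Set.Finite.mem_toFinset]
  exact Set.mem_biUnion (Finset.mem_range.mpr hbn) hmin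

theorem statement19
    (𝒜 : ℤ → AddSubgroup R) [GradedRing 𝒜]
    (hNoeth : IsNoetherianRing R)
    (hnonneg : ∀ i : ℤ, i < 0 → 𝒜 i = ⊥)
    -- `R₀ = k` is an infinite field
    (hfield : IsField ↥(𝒜 0)) (hinf : Infinite ↥(𝒜 0))
    -- `M` is a graded `R`-module generated by homogeneous elements of one degree
    (M : Type) [AddCommGroup M] [Module R M]
    (ℳ : ℤ → AddSubgroup M) [DirectSum.Decomposition ℳ] [SetLike.GradedSMul 𝒜 ℳ]
    (n : ℕ) (m : Fin n → M) (deg : ℤ)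
    (hmhomog : ∀ i, m i ∈ ℳ deg)
    (hmgen : Submodule.span R (Set.range m) = ⊤)
    -- the fixed integers `r` and `s`
    (r s : ℤ)
    -- `μ(M_𝔭) ≤ max{0, dim R_𝔭 + r}` whenever `dim R_𝔭 ≤ s − 1`
    (hmu : ∀ (𝔭 : PrimeSpectrum R) (h : ℕ),
      ringKrullDim (Localization.AtPrime 𝔭.asIdeal) = (h : WithBot (WithTop ℕ)) →
      (h : ℤ) ≤ s - 1 → LocCanGenBy 𝔭 M (max 0 ((h : ℤ) + r))) :
    -- conclusion: for a general `k`-linear combination `x` of `m₁,…,mₙ`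
    ∃ f : MvPolynomial (Fin n) ↥(𝒜 0), f ≠ 0 ∧
      ∀ lam : Fin n → ↥(𝒜 0), MvPolynomial.eval lam f ≠ 0 →
        ∀ (𝔭 : PrimeSpectrum R) (h : ℕ),
          ringKrullDim (Localization.AtPrime 𝔭.asIdeal) = (h : WithBot (WithTop ℕ)) →
          (h : ℤ) ≤ s - 1 →
          LocCanGenBy 𝔭
            (M ⧸ Submodule.span R {∑ i, ((lam i : R) • m i)})
            (max 0 ((h : ℤ) + r - 1)) := by
  let : Field ↥(𝒜 0) := hfield.toField
  let φ : ↥(𝒜 0) →+* R :=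
    { toFun := Subtype.val
      map_one' := rfl
      map_mul' := fun _ _ ↦ rfl
      map_zero' := rfl
      map_add' := fun _ _ ↦ rfl }
  let : Algebra ↥(𝒜 0) R := φ.toAlgebra
  have : Module.Finite R M := ⟨⟨(Set.finite_range m).toFinset, by simpa⟩⟩
  have hdim (p : PrimeSpectrum R) (h : ℕ) :
      ringKrullDim (Localization.AtPrime p.asIdeal) = (h : WithBot (WithTop ℕ)) ↔
        p.asIdeal.height = h := by
    rw [IsLocalization.AtPrime.ringKrullDim_eq_height p.asIdeal]
    exact WithBot.coe_inj
  obtain ⟨f, hf, H⟩ := exists_mvPolynomial_forall_spannedNear_quotient (K := ↥(𝒜 0)) m hmgen r s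
    fun p hp h hh hs ↦ (locCanGenBy_iff_spannedNear ⟨p, hp⟩ _).mp <| by
      rw [Int.toNat_eq_max, max_comm]
      exact hmu ⟨p, hp⟩ h ((hdim ⟨p, hp⟩ h).mpr hh) hs
  refine ⟨f, hf, fun lam hlam p h hh hs ↦ ?_⟩
  rw [max_comm, ← Int.toNat_eq_max, locCanGenBy_iff_spannedNear]
  exact H lam hlam p.asIdeal h ((hdim p h).mp hh) hs


end Paper
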